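/- arXiv:1103.4964 — 2 statements merged into one kernel-verified Lean document; each statement's English description precedes it below -/
import Mathlib

section
/- The maps π'(α⊗u^j) = (α,0)⊗u^j and ∮'((α,β)⊗u^j) = β⊗u^j are morphisms of cochain complexes π' : (Ω⊗ℝ[u], d⊗1) → (C,∇) and ∮' : (C,∇) → (G[−1]⊗ℝ[u], d⊗1) (where G[−1] places G^n in degree n+1), and the sequence 0 → Ω⊗ℝ[u] →^{π'} C →^{∮'} G[−1]⊗ℝ[u] → 0 is exact in every degree. -/
/-!
Common algebraic model for the paper "Intersection cohomology of circle actions"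
(Padilla–Saralegi), following the CONTEXT of the statements.

`A` models the (total space of the) graded-commutative differential graded ℝ-algebra
`A = ⊕ₙ Aⁿ` of liftable forms on the orbit space `B`; the grading is only recorded
through the families of graded subspaces `P Q : ℤ → Submodule ℝ A` (the forms of
perverse degree `≤ p̄` resp. `≤ p̄ - x̄`), which vanish in negative degrees
(`Aⁿ = 0` for `n < 0`).  The differential is `d` with `d ∘ d = 0`, and
`e : A →ₗ[ℝ] A` is right multiplication by the fixed Euler form `ε ∈ A²`;
the hypotheses `dε = 0` together with the graded Leibniz rule amount exactly to
the commutation `d ∘ e = e ∘ d`, which is how we encode them.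
-/

open Submodule LinearMap

noncomputable section

namespace IG

variable {A : Type*} [AddCommGroup A] [Module ℝ A]

/-- `Ω^n = {α ∈ P^n : dα ∈ P^(n+1)}`. -/
def Om (d : A →ₗ[ℝ] A) (P : ℤ → Submodule ℝ A) (n : ℤ) : Submodule ℝ A :=
  P n ⊓ (P (n + 1)).comap d

/-- First component of `D` in degree `n` : `(α, β) ↦ dα + (-1)^(n-1) β∧ε`. -/
def D1 (d e : A →ₗ[ℝ] A) (n : ℤ) : A × A →ₗ[ℝ] A :=
  d ∘ₗ LinearMap.fst ℝ A A + ((-1 : ℝ) ^ (n - 1)) • (e ∘ₗ LinearMap.snd ℝ A A)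

/-- `D(α,β) = (dα + (-1)^(n-1) β∧ε, dβ)` in degree `n`. -/
def Dmap (d e : A →ₗ[ℝ] A) (n : ℤ) : A × A →ₗ[ℝ] A × A :=
  (D1 d e n).prod (d ∘ₗ LinearMap.snd ℝ A A)

/-- `K^n = {(α,β) ∈ P^n × Q^(n-1) : dβ ∈ Q^n, dα + (-1)^(n-1) β∧ε ∈ P^(n+1)}`. -/
def Ksub (d e : A →ₗ[ℝ] A) (P Q : ℤ → Submodule ℝ A) (n : ℤ) : Submodule ℝ (A × A) :=
  (P n).comap (LinearMap.fst ℝ A A) ⊓ (Q (n - 1)).comap (LinearMap.snd ℝ A A) ⊓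
    (Q n).comap (d ∘ₗ LinearMap.snd ℝ A A) ⊓ (P (n + 1)).comap (D1 d e n)

/-- `G^n = {β ∈ Q^n : dβ ∈ Q^(n+1), ∃ α ∈ P^(n+1), dα + (-1)^n β∧ε ∈ P^(n+2)}`. -/
def Gsub (d e : A →ₗ[ℝ] A) (P Q : ℤ → Submodule ℝ A) (n : ℤ) : Submodule ℝ A :=
  Q n ⊓ (Q (n + 1)).comap d ⊓
    (((P (n + 1)).comap (LinearMap.fst ℝ A A) ⊓
        (P (n + 2)).comap
          (d ∘ₗ LinearMap.fst ℝ A A + ((-1 : ℝ) ^ n) • (e ∘ₗ LinearMap.snd ℝ A A))).map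
      (LinearMap.snd ℝ A A))

/-- `C^m = ⊕_{i+2j=m} K^i ⊗ ℝ·u^j`, realized as the functions `ω : ℕ → A × A`
(`ω j` = the coefficient of `u^j`) with `ω j ∈ K^(m-2j)` for all `j`. -/
def Csub (d e : A →ₗ[ℝ] A) (P Q : ℤ → Submodule ℝ A) (m : ℤ) : Submodule ℝ (ℕ → A × A) :=
  ⨅ j : ℕ, (Ksub d e P Q (m - 2 * (j : ℤ))).comap (LinearMap.proj (R := ℝ) j)

/-- `∇((α,β) ⊗ u^j) = D(α,β) ⊗ u^j + (-1)^(n-1) (β,0) ⊗ u^(j+1)` on total degree `m`. -/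
def nabla (d e : A →ₗ[ℝ] A) (m : ℤ) : (ℕ → A × A) →ₗ[ℝ] (ℕ → A × A) :=
  LinearMap.pi fun j : ℕ =>
    Dmap d e (m - 2 * (j : ℤ)) ∘ₗ LinearMap.proj j +
      if j = 0 then 0
      else ((-1 : ℝ) ^ (m - 2 * ((j : ℤ) - 1) - 1)) •
        (LinearMap.inl ℝ A A ∘ₗ LinearMap.snd ℝ A A ∘ₗ LinearMap.proj (j - 1))

/-- Multiplication by `u` (degree 2) on an `ℝ[u]`-module realized as `ℕ → M`. -/
def shiftL (M : Type*) [AddCommGroup M] [Module ℝ M] : (ℕ → M) →ₗ[ℝ] (ℕ → M) :=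
  LinearMap.pi fun j : ℕ => if j = 0 then 0 else LinearMap.proj (j - 1)

/-- `π' (α ⊗ u^j) = (α, 0) ⊗ u^j`. -/
def piMap : (ℕ → A) →ₗ[ℝ] ℕ → A × A :=
  LinearMap.pi fun j : ℕ => LinearMap.inl ℝ A A ∘ₗ LinearMap.proj j

/-- `∮' ((α,β) ⊗ u^j) = β ⊗ u^j`. -/
def ointMap : (ℕ → A × A) →ₗ[ℝ] ℕ → A :=
  LinearMap.pi fun j : ℕ => LinearMap.snd ℝ A A ∘ₗ LinearMap.proj j

/-- `d ⊗ 1`. -/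
def dpi (d : A →ₗ[ℝ] A) : (ℕ → A) →ₗ[ℝ] ℕ → A :=
  LinearMap.pi fun j : ℕ => d ∘ₗ LinearMap.proj j

/-- `(Ω ⊗ ℝ[u])^m`. -/
def OmC (d : A →ₗ[ℝ] A) (P : ℤ → Submodule ℝ A) (m : ℤ) : Submodule ℝ (ℕ → A) :=
  ⨅ j : ℕ, (Om d P (m - 2 * (j : ℤ))).comap (LinearMap.proj (R := ℝ) j)

/-- `(G[-1] ⊗ ℝ[u])^m` (`G[-1]` places `G^n` in degree `n+1`). -/
def GCs (d e : A →ₗ[ℝ] A) (P Q : ℤ → Submodule ℝ A) (m : ℤ) : Submodule ℝ (ℕ → A) :=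
  ⨅ j : ℕ, (Gsub d e P Q (m - 1 - 2 * (j : ℤ))).comap (LinearMap.proj (R := ℝ) j)

/-- Cohomology presented as (cocycles) / (coboundaries). -/
abbrev Hq {M : Type*} [AddCommGroup M] [Module ℝ M] (Z B : Submodule ℝ M) :=
  Z ⧸ (B.comap Z.subtype)

/-- Cocycles of `Ω`. -/
def ZOm (d : A →ₗ[ℝ] A) (P : ℤ → Submodule ℝ A) (n : ℤ) : Submodule ℝ A :=
  Om d P n ⊓ LinearMap.ker d

/-- Coboundaries of `Ω`. -/
def BOm (d : A →ₗ[ℝ] A) (P : ℤ → Submodule ℝ A) (n : ℤ) : Submodule ℝ A :=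
  (Om d P (n - 1)).map d

/-- `H^n(Ω)`. -/
abbrev HOm (d : A →ₗ[ℝ] A) (P : ℤ → Submodule ℝ A) (n : ℤ) :=
  Hq (ZOm d P n) (BOm d P n)

/-- Cocycles of `G`. -/
def ZG (d e : A →ₗ[ℝ] A) (P Q : ℤ → Submodule ℝ A) (n : ℤ) : Submodule ℝ A :=
  Gsub d e P Q n ⊓ LinearMap.ker d

/-- Coboundaries of `G`. -/
def BG (d e : A →ₗ[ℝ] A) (P Q : ℤ → Submodule ℝ A) (n : ℤ) : Submodule ℝ A :=
  (Gsub d e P Q (n - 1)).map d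

/-- `H^n(G)`. -/
abbrev HG (d e : A →ₗ[ℝ] A) (P Q : ℤ → Submodule ℝ A) (n : ℤ) :=
  Hq (ZG d e P Q n) (BG d e P Q n)

/-- The co-Gysin space `𝒦^n = Ω^n / G^n` (cochain level). -/
abbrev Kq (d e : A →ₗ[ℝ] A) (P Q : ℤ → Submodule ℝ A) (n : ℤ) :=
  (Om d P n) ⧸ ((Gsub d e P Q n).comap (Om d P n).subtype)

/-- Cocycles of the co-Gysin complex `𝒦 = Ω/G`, presented by representatives:
`α ∈ Ω^n` with `dα ∈ G^(n+1)`. -/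
def ZKo (d e : A →ₗ[ℝ] A) (P Q : ℤ → Submodule ℝ A) (n : ℤ) : Submodule ℝ A :=
  Om d P n ⊓ (Gsub d e P Q (n + 1)).comap d

/-- Representatives of coboundaries of `𝒦 = Ω/G`. -/
def BKo (d e : A →ₗ[ℝ] A) (P Q : ℤ → Submodule ℝ A) (n : ℤ) : Submodule ℝ A :=
  Gsub d e P Q n ⊔ (Om d P (n - 1)).map d

/-- `H^n(𝒦)`. -/
abbrev HKo (d e : A →ₗ[ℝ] A) (P Q : ℤ → Submodule ℝ A) (n : ℤ) :=
  Hq (ZKo d e P Q n) (BKo d e P Q n)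

/-- Cocycles of `(C, ∇)`. -/
def ZC (d e : A →ₗ[ℝ] A) (P Q : ℤ → Submodule ℝ A) (m : ℤ) : Submodule ℝ (ℕ → A × A) :=
  Csub d e P Q m ⊓ LinearMap.ker (nabla d e m)

/-- Coboundaries of `(C, ∇)`. -/
def BC (d e : A →ₗ[ℝ] A) (P Q : ℤ → Submodule ℝ A) (m : ℤ) : Submodule ℝ (ℕ → A × A) :=
  (Csub d e P Q (m - 1)).map (nabla d e (m - 1))

/-- `H^m(C)`, the equivariant intersection cohomology. -/
abbrev HC (d e : A →ₗ[ℝ] A) (P Q : ℤ → Submodule ℝ A) (m : ℤ) :=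
  Hq (ZC d e P Q m) (BC d e P Q m)

/-- Cocycles of `(Ω ⊗ ℝ[u], d ⊗ 1)`. -/
def ZOmC (d : A →ₗ[ℝ] A) (P : ℤ → Submodule ℝ A) (m : ℤ) : Submodule ℝ (ℕ → A) :=
  OmC d P m ⊓ LinearMap.ker (dpi d)

/-- Coboundaries of `(Ω ⊗ ℝ[u], d ⊗ 1)`. -/
def BOmC (d : A →ₗ[ℝ] A) (P : ℤ → Submodule ℝ A) (m : ℤ) : Submodule ℝ (ℕ → A) :=
  (OmC d P (m - 1)).map (dpi d)

/-- `[H(Ω) ⊗ ℝ[u]]^m`, as the cohomology of the complex `(Ω ⊗ ℝ[u], d ⊗ 1)`. -/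
abbrev HOmCq (d : A →ₗ[ℝ] A) (P : ℤ → Submodule ℝ A) (m : ℤ) :=
  Hq (ZOmC d P m) (BOmC d P m)

/-- Cocycles of `(G[-1] ⊗ ℝ[u], d ⊗ 1)`. -/
def ZGC (d e : A →ₗ[ℝ] A) (P Q : ℤ → Submodule ℝ A) (m : ℤ) : Submodule ℝ (ℕ → A) :=
  GCs d e P Q m ⊓ LinearMap.ker (dpi d)

/-- Coboundaries of `(G[-1] ⊗ ℝ[u], d ⊗ 1)`. -/
def BGC (d e : A →ₗ[ℝ] A) (P Q : ℤ → Submodule ℝ A) (m : ℤ) : Submodule ℝ (ℕ → A) :=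
  (GCs d e P Q (m - 1)).map (dpi d)

/-- `[H(G) ⊗ ℝ[u]]^(m-1)`, as the cohomology of `(G[-1] ⊗ ℝ[u], d ⊗ 1)` in degree `m`. -/
abbrev HGCq (d e : A →ₗ[ℝ] A) (P Q : ℤ → Submodule ℝ A) (m : ℤ) :=
  Hq (ZGC d e P Q m) (BGC d e P Q m)

/-- The subspace of `ω : ℕ → A × A` supported in (filtration) degrees `≥ i`
(for total degree `m`): `ω j = 0` whenever `m - 2j < i`. -/
def Supp (i m : ℤ) : Submodule ℝ (ℕ → A × A) :=
  ⨅ (j : ℕ) (_ : m - 2 * (j : ℤ) < i),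
    LinearMap.ker (LinearMap.proj (R := ℝ) (φ := fun _ : ℕ => A × A) j)

/-- The filtration `F^i C^m = {ω ∈ ⊕_{i'≥i} K^{i'} ⊗ ℝ[u] of total degree m :
∇ω ∈ ⊕_{i'≥i} K^{i'} ⊗ ℝ[u]}`. -/
def FC (d e : A →ₗ[ℝ] A) (P Q : ℤ → Submodule ℝ A) (i m : ℤ) : Submodule ℝ (ℕ → A × A) :=
  Csub d e P Q m ⊓ Supp i m ⊓ (Supp i (m + 1)).comap (nabla d e m)

/-- `Z_r^{i,j} = F^i C^(i+j) ∩ ∇⁻¹(F^(i+r) C^(i+j+1))`. -/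
def Zsp (d e : A →ₗ[ℝ] A) (P Q : ℤ → Submodule ℝ A) (r i j : ℤ) : Submodule ℝ (ℕ → A × A) :=
  FC d e P Q i (i + j) ⊓ (FC d e P Q (i + r) (i + j + 1)).comap (nabla d e (i + j))

/-- `B_r^{i,j} = F^i C^(i+j) ∩ ∇(F^(i-r) C^(i+j-1))`. -/
def Bsp (d e : A →ₗ[ℝ] A) (P Q : ℤ → Submodule ℝ A) (r i j : ℤ) : Submodule ℝ (ℕ → A × A) :=
  FC d e P Q i (i + j) ⊓ (FC d e P Q (i - r) (i + j - 1)).map (nabla d e (i + j - 1))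

/-- `E_r^{i,j} = Z_r^{i,j} / (Z_(r-1)^{i+1,j-1} + B_(r-1)^{i,j})`. -/
abbrev Esp (d e : A →ₗ[ℝ] A) (P Q : ℤ → Submodule ℝ A) (r i j : ℤ) :=
  Zsp d e P Q r i j ⧸
    ((Zsp d e P Q (r - 1) (i + 1) (j - 1) ⊔ Bsp d e P Q (r - 1) i j).comap
      (Zsp d e P Q r i j).subtype)

/-- The differential `d_r : E_r^{i,j} → E_r^{i+r,j-r+1}` is the map induced by `∇`
(the target indices `(i', j')` are given freely, to be instantiated by
expressions equal to `(i + r, j - r + 1)`). -/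
def DrChar (d e : A →ₗ[ℝ] A) (P Q : ℤ → Submodule ℝ A) (r i j i' j' : ℤ)
    (dr : Esp d e P Q r i j →ₗ[ℝ] Esp d e P Q r i' j') : Prop :=
  ∀ (ω : ℕ → A × A) (hω : ω ∈ Zsp d e P Q r i j)
    (hω' : nabla d e (i + j) ω ∈ Zsp d e P Q r i' j'),
    dr (Submodule.Quotient.mk ⟨ω, hω⟩) = Submodule.Quotient.mk ⟨nabla d e (i + j) ω, hω'⟩

/-- `α ↦ (α, 0) ⊗ u^0 = (α,0) ⊗ 1`. -/
def embL : A →ₗ[ℝ] ℕ → A × A :=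
  LinearMap.single ℝ (fun _ : ℕ => A × A) 0 ∘ₗ LinearMap.inl ℝ A A

/-- `ι̃ : H^n(G) → H^{n'}(Ω)` induced by the inclusion `G ⊆ Ω` (`n' = n`). -/
def iotaChar (d e : A →ₗ[ℝ] A) (P Q : ℤ → Submodule ℝ A) (n n' : ℤ)
    (ι : HG d e P Q n →ₗ[ℝ] HOm d P n') : Prop :=
  ∀ (β : A) (hβ : β ∈ ZG d e P Q n) (hβ' : β ∈ ZOm d P n'),
    ι (Submodule.Quotient.mk ⟨β, hβ⟩) = Submodule.Quotient.mk ⟨β, hβ'⟩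

/-- `𝕖 : H^n(G) → H^{n'}(Ω)`, `𝕖[β] = [dα + (-1)^n β∧ε]` for any witness `α`
(`n' = n + 2`). -/
def eulerChar (d e : A →ₗ[ℝ] A) (P Q : ℤ → Submodule ℝ A) (n n' : ℤ)
    (E : HG d e P Q n →ₗ[ℝ] HOm d P n') : Prop :=
  ∀ (β : A) (hβ : β ∈ ZG d e P Q n) (α : A) (_ : α ∈ P (n + 1))
    (hz : d α + ((-1 : ℝ) ^ n) • e β ∈ ZOm d P n'),
    E (Submodule.Quotient.mk ⟨β, hβ⟩) =
      Submodule.Quotient.mk ⟨d α + ((-1 : ℝ) ^ n) • e β, hz⟩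

/-- `∂ : H^n(𝒦) → H^{n'}(G)`, `∂[ᾱ] = [dα]` (`n' = n + 1`). -/
def partialChar (d e : A →ₗ[ℝ] A) (P Q : ℤ → Submodule ℝ A) (n n' : ℤ)
    (pd : HKo d e P Q n →ₗ[ℝ] HG d e P Q n') : Prop :=
  ∀ (α : A) (hα : α ∈ ZKo d e P Q n) (hd : d α ∈ ZG d e P Q n'),
    pd (Submodule.Quotient.mk ⟨α, hα⟩) = Submodule.Quotient.mk ⟨d α, hd⟩

/-- `Pr : H^n(Ω) → H^{n'}(𝒦)` induced by the projection `Ω → 𝒦 = Ω/G` (`n' = n`). -/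
def prChar (d e : A →ₗ[ℝ] A) (P Q : ℤ → Submodule ℝ A) (n n' : ℤ)
    (pr : HOm d P n →ₗ[ℝ] HKo d e P Q n') : Prop :=
  ∀ (α : A) (hα : α ∈ ZOm d P n) (hα' : α ∈ ZKo d e P Q n'),
    pr (Submodule.Quotient.mk ⟨α, hα⟩) = Submodule.Quotient.mk ⟨α, hα'⟩

theorem mem_Om (d : A →ₗ[ℝ] A) (P : ℤ → Submodule ℝ A) (n : ℤ) (α : A) :
    α ∈ Om d P n ↔ α ∈ P n ∧ d α ∈ P (n + 1) := Iff.rfl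

theorem mem_OmC (d : A →ₗ[ℝ] A) (P : ℤ → Submodule ℝ A) (m : ℤ) (ω : ℕ → A) :
    ω ∈ OmC d P m ↔ ∀ j : ℕ, ω j ∈ Om d P (m - 2 * (j : ℤ)) := by
  simp [OmC]

theorem mem_Ksub (d e : A →ₗ[ℝ] A) (P Q : ℤ → Submodule ℝ A) (n : ℤ) (x : A × A) :
    x ∈ Ksub d e P Q n ↔ x.1 ∈ P n ∧ x.2 ∈ Q (n - 1) ∧ d x.2 ∈ Q n ∧
      d x.1 + ((-1 : ℝ) ^ (n - 1)) • e x.2 ∈ P (n + 1) := by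
  simp [Ksub, D1, and_assoc]

theorem mem_Csub (d e : A →ₗ[ℝ] A) (P Q : ℤ → Submodule ℝ A) (m : ℤ) (ω : ℕ → A × A) :
    ω ∈ Csub d e P Q m ↔ ∀ j : ℕ, ω j ∈ Ksub d e P Q (m - 2 * (j : ℤ)) := by
  simp [Csub]

theorem mem_Gsub (d e : A →ₗ[ℝ] A) (P Q : ℤ → Submodule ℝ A) (n : ℤ) (β : A) :
    β ∈ Gsub d e P Q n ↔ β ∈ Q n ∧ d β ∈ Q (n + 1) ∧
      ∃ α ∈ P (n + 1), d α + ((-1 : ℝ) ^ n) • e β ∈ P (n + 2) := by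
  simp [Gsub, and_assoc]

theorem mem_GCs (d e : A →ₗ[ℝ] A) (P Q : ℤ → Submodule ℝ A) (m : ℤ) (g : ℕ → A) :
    g ∈ GCs d e P Q m ↔ ∀ j : ℕ, g j ∈ Gsub d e P Q (m - 1 - 2 * (j : ℤ)) := by
  simp [GCs]

/-- `G^(n-1)` is the image of `K^n` under the second projection. -/
theorem mem_Gsub_sub_one_iff_exists_mem_Ksub (d e : A →ₗ[ℝ] A) (P Q : ℤ → Submodule ℝ A)
    (n : ℤ) (β : A) :
    β ∈ Gsub d e P Q (n - 1) ↔ ∃ α, (α, β) ∈ Ksub d e P Q n := by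
  have h : n - 1 + 2 = n + 1 := by ring
  simp only [mem_Gsub, mem_Ksub, sub_add_cancel, h]
  grind

/-- `(α, 0)` lies in `K^n` exactly when `α` lies in `Ω^n`. -/
theorem mk_zero_mem_Ksub_iff (d e : A →ₗ[ℝ] A) (P Q : ℤ → Submodule ℝ A) (n : ℤ) (α : A) :
    (α, (0 : A)) ∈ Ksub d e P Q n ↔ α ∈ Om d P n := by
  simp [mem_Ksub, mem_Om]

/-- `π'(α⊗u^j) = (α,0)⊗u^j` and `∮'((α,β)⊗u^j) = β⊗u^j` are morphisms of
cochain complexes `π' : (Ω⊗ℝ[u], d⊗1) → (C,∇)` and `∮' : (C,∇) → (G[-1]⊗ℝ[u], d⊗1)`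
(where `G[-1]` places `G^n` in degree `n+1`), and the sequence
`0 → Ω⊗ℝ[u] → C → G[-1]⊗ℝ[u] → 0` is exact in every degree. -/
theorem statement_2 {A : Type*} [AddCommGroup A] [Module ℝ A]
    (d e : A →ₗ[ℝ] A) (hd : d ∘ₗ d = 0) (hde : d ∘ₗ e = e ∘ₗ d)
    (P Q : ℤ → Submodule ℝ A) (hQP : ∀ n, Q n ≤ P n)
    (hPneg : ∀ n : ℤ, n < 0 → P n = ⊥) (hQneg : ∀ n : ℤ, n < 0 → Q n = ⊥) :
    -- π' is a morphism of cochain complexes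
    (∀ (m : ℤ) (ω : ℕ → A), ω ∈ OmC d P m → piMap ω ∈ Csub d e P Q m) ∧
    (∀ (m : ℤ) (ω : ℕ → A), ω ∈ OmC d P m →
      nabla d e m (piMap ω) = piMap (dpi d ω)) ∧
    -- ∮' is a morphism of cochain complexes
    (∀ (m : ℤ) (ω : ℕ → A × A), ω ∈ Csub d e P Q m → ointMap ω ∈ GCs d e P Q m) ∧
    (∀ (m : ℤ) (ω : ℕ → A × A), ω ∈ Csub d e P Q m →
      dpi d (ointMap ω) = ointMap (nabla d e m ω)) ∧
    -- exactness at Ω⊗ℝ[u]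
    (∀ (m : ℤ) (ω : ℕ → A), ω ∈ OmC d P m → piMap ω = 0 → ω = 0) ∧
    -- exactness at C
    (∀ m : ℤ, Csub d e P Q m ⊓ LinearMap.ker (ointMap (A := A)) = (OmC d P m).map piMap) ∧
    -- exactness at G[-1]⊗ℝ[u]
    (∀ (m : ℤ) (g : ℕ → A), g ∈ GCs d e P Q m →
      ∃ ω ∈ Csub d e P Q m, ointMap ω = g) := by
  have hi (m : ℤ) (j : ℕ) : m - 1 - 2 * (j : ℤ) = m - 2 * (j : ℤ) - 1 := by ring
  refine ⟨fun m ω h => ?_, fun m ω _ => ?_, fun m ω h => ?_, fun m ω _ => ?_, fun m ω _ h => ?_,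
    fun m => ?_, fun m g h => ?_⟩
  · rw [mem_OmC] at h
    exact (mem_Csub ..).2 fun j => (mk_zero_mem_Ksub_iff ..).2 (h j)
  · funext j
    by_cases hj : j = 0 <;> simp [nabla, piMap, dpi, Dmap, D1, hj]
  · rw [mem_Csub] at h
    refine (mem_GCs ..).2 fun j => ?_
    rw [hi, mem_Gsub_sub_one_iff_exists_mem_Ksub]
    exact ⟨(ω j).1, h j⟩
  · funext j
    by_cases hj : j = 0 <;> simp [nabla, ointMap, dpi, Dmap, hj]
  · funext j
    exact congrArg Prod.fst (congrFun h j)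
  · ext ω
    constructor
    · rintro ⟨h, h0⟩
      have hω (j : ℕ) : ω j = ((ω j).1, 0) := Prod.ext rfl (congrFun h0 j)
      refine ⟨fun j => (ω j).1, (mem_OmC ..).2 fun j => ?_, funext fun j => (hω j).symm⟩
      rw [← mk_zero_mem_Ksub_iff d e P Q, ← hω]
      exact (mem_Csub ..).1 h j
    · rintro ⟨α, h, rfl⟩
      exact ⟨(mem_Csub ..).2 fun j => (mk_zero_mem_Ksub_iff ..).2 ((mem_OmC ..).1 h j), rfl⟩
  · simp only [mem_GCs, hi, mem_Gsub_sub_one_iff_exists_mem_Ksub] at h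
    choose α hα using h
    exact ⟨fun j => (α j, g j), (mem_Csub ..).2 hα, rfl⟩

end IG

end
end

section
/- For each i there is a well-defined ℝ-linear map 𝕖 : H^i(G) → H^{i+2}(Ω) such that for every cocycle β ∈ G^i (dβ = 0) and every α ∈ P^{i+1} with dα + (−1)^i β∧ε ∈ P^{i+2}, one has 𝕖[β] = [dα + (−1)^i β∧ε]. In particular dα + (−1)^i β∧ε is a cocycle of the complex Ω, its cohomology class does not depend on the choice of the witness α, and it depends only on the class of β in H^i(G). -/
/-!
Common algebraic model for the paper "Intersection cohomology of circle actions"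
(Padilla–Saralegi), following the CONTEXT of the statements.

`A` models the (total space of the) graded-commutative differential graded ℝ-algebra
`A = ⊕ₙ Aⁿ` of liftable forms on the orbit space `B`; the grading is only recorded
through the families of graded subspaces `P Q : ℤ → Submodule ℝ A` (the forms of
perverse degree `≤ p̄` resp. `≤ p̄ - x̄`), which vanish in negative degrees
(`Aⁿ = 0` for `n < 0`).  The differential is `d` with `d ∘ d = 0`, and
`e : A →ₗ[ℝ] A` is right multiplication by the fixed Euler form `ε ∈ A²`;
the hypotheses `dε = 0` together with the graded Leibniz rule amount exactly to
the commutation `d ∘ e = e ∘ d`, which is how we encode them.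
-/

open Submodule LinearMap

noncomputable section

namespace IG

variable {A : Type*} [AddCommGroup A] [Module ℝ A]

/-- For a cocycle `β` of `G` and a witness `α`, the Euler form is a cocycle of `Ω`. -/
lemma euler_mem_ZOm {d e : A →ₗ[ℝ] A} (hd : d ∘ₗ d = 0) (hde : d ∘ₗ e = e ∘ₗ d)
    {P : ℤ → Submodule ℝ A} {n : ℤ} {α β : A} (hβ : d β = 0)
    (h : d α + ((-1 : ℝ) ^ n) • e β ∈ P (n + 2)) :
    d α + ((-1 : ℝ) ^ n) • e β ∈ ZOm d P (n + 2) := by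
  have hd0 : d (d α + ((-1 : ℝ) ^ n) • e β) = 0 := by
    have h₁ : d (d α) = 0 := LinearMap.congr_fun hd α
    have h₂ : d (e β) = e (d β) := LinearMap.congr_fun hde β
    rw [map_add, map_smul, h₁, h₂, hβ, map_zero, smul_zero, add_zero]
  refine ⟨⟨h, ?_⟩, hd0⟩
  rw [SetLike.mem_coe, Submodule.mem_comap, hd0]
  exact zero_mem _

/-- If `β` is a coboundary of `G`, then for every witness `α` the Euler form is a coboundary
of `Ω`. -/
lemma euler_mem_BOm {d e : A →ₗ[ℝ] A} (hd : d ∘ₗ d = 0) (hde : d ∘ₗ e = e ∘ₗ d)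
    {P Q : ℤ → Submodule ℝ A} {n : ℤ} {α β : A} (hβ : β ∈ BG d e P Q n)
    (hα : α ∈ P (n + 1)) (h : d α + ((-1 : ℝ) ^ n) • e β ∈ P (n + 2)) :
    d α + ((-1 : ℝ) ^ n) • e β ∈ BOm d P (n + 2) := by
  obtain ⟨γ, ⟨-, ⟨α', γ'⟩, ⟨-, hη⟩, rfl⟩, rfl⟩ := hβ
  have hη' : d α' + ((-1 : ℝ) ^ (n - 1)) • e γ' ∈ P (n + 1) := by
    have h₁ : d α' + ((-1 : ℝ) ^ (n - 1)) • e γ' ∈ P (n - 1 + 2) := hη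
    rwa [show n - 1 + 2 = n + 1 by ring] at h₁
  have hsign : (-1 : ℝ) ^ n = -(-1 : ℝ) ^ (n - 1) := by
    rw [zpow_sub_one₀ (by norm_num)]
    norm_num
  have key : d (α - (d α' + ((-1 : ℝ) ^ (n - 1)) • e γ')) =
      d α + ((-1 : ℝ) ^ n) • e (d γ') := by
    have h₁ : d (d α') = 0 := LinearMap.congr_fun hd α'
    have h₂ : d (e γ') = e (d γ') := LinearMap.congr_fun hde γ'
    rw [map_sub, map_add, map_smul, h₁, h₂, hsign, zero_add, neg_smul, sub_eq_add_neg]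
  refine ⟨α - (d α' + ((-1 : ℝ) ^ (n - 1)) • e γ'), ⟨?_, ?_⟩, key⟩
  · rw [show n + 2 - 1 = n + 1 by ring]
    exact sub_mem hα hη'
  · rw [SetLike.mem_coe, Submodule.mem_comap, key, show n + 2 - 1 + 1 = n + 2 by ring]
    exact h

/-- Pairs `(α, β)` where `β` is a cocycle of `G^n` and `α` is a witness for `β`. -/
def witnessSub (d e : A →ₗ[ℝ] A) (P Q : ℤ → Submodule ℝ A) (n : ℤ) : Submodule ℝ (A × A) :=
  (ZG d e P Q n).comap (LinearMap.snd ℝ A A) ⊓ ((P (n + 1)).comap (LinearMap.fst ℝ A A) ⊓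
    (P (n + 2)).comap
      (d ∘ₗ LinearMap.fst ℝ A A + ((-1 : ℝ) ^ n) • (e ∘ₗ LinearMap.snd ℝ A A)))

/-- Witnesses can be chosen linearly in the cocycle. -/
lemma exists_linear_witness (d e : A →ₗ[ℝ] A) (P Q : ℤ → Submodule ℝ A) (n : ℤ) :
    ∃ s : ZG d e P Q n →ₗ[ℝ] A, ∀ β : ZG d e P Q n, s β ∈ P (n + 1) ∧
      d (s β) + ((-1 : ℝ) ^ n) • e β ∈ P (n + 2) := by
  let f : witnessSub d e P Q n →ₗ[ℝ] ZG d e P Q n :=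
    (LinearMap.snd ℝ A A).restrict fun _ h => h.1
  have hf : Function.Surjective f := by
    rintro ⟨β, hβ⟩
    obtain ⟨⟨-, ⟨α, β'⟩, hα, rfl⟩, -⟩ := id hβ
    exact ⟨⟨(α, β'), hβ, hα⟩, rfl⟩
  obtain ⟨g, hg⟩ := f.exists_rightInverse_of_surjective (LinearMap.range_eq_top.2 hf)
  refine ⟨LinearMap.fst ℝ A A ∘ₗ (witnessSub d e P Q n).subtype ∘ₗ g, fun β => ?_⟩
  have hsnd : (g β : A × A).2 = β := congrArg Subtype.val (LinearMap.congr_fun hg β)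
  obtain ⟨-, h₁, h₂⟩ := (g β).2
  refine ⟨h₁, ?_⟩
  rw [← hsnd]
  exact h₂

/-- For each `n` there is a well-defined `ℝ`-linear map
`𝕖 : H^n(G) → H^(n+2)(Ω)` such that for every cocycle `β ∈ G^n` (`dβ = 0`) and every
`α ∈ P^(n+1)` with `dα + (-1)^n β∧ε ∈ P^(n+2)`, one has `𝕖[β] = [dα + (-1)^n β∧ε]`.
In particular `dα + (-1)^n β∧ε` is a cocycle of the complex `Ω`, its cohomology class
does not depend on the choice of the witness `α`, and it depends only on the class of
`β` in `H^n(G)` (this is precisely the well-definedness of the linear map `𝕖`). -/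
theorem statement_3 {A : Type*} [AddCommGroup A] [Module ℝ A]
    (d e : A →ₗ[ℝ] A) (hd : d ∘ₗ d = 0) (hde : d ∘ₗ e = e ∘ₗ d)
    (P Q : ℤ → Submodule ℝ A) (hQP : ∀ n, Q n ≤ P n)
    (hPneg : ∀ n : ℤ, n < 0 → P n = ⊥) (hQneg : ∀ n : ℤ, n < 0 → Q n = ⊥)
    (n : ℤ) :
    -- the candidate representative is a cocycle of Ω
    (∀ β ∈ ZG d e P Q n, ∀ α ∈ P (n + 1),
      d α + ((-1 : ℝ) ^ n) • e β ∈ P (n + 2) →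
        d α + ((-1 : ℝ) ^ n) • e β ∈ ZOm d P (n + 2)) ∧
    -- existence of the well-defined induced map 𝕖
    ∃ E : HG d e P Q n →ₗ[ℝ] HOm d P (n + 2), eulerChar d e P Q n (n + 2) E := by
  refine ⟨fun β hβ α _ h => euler_mem_ZOm hd hde hβ.2 h, ?_⟩
  obtain ⟨s, hs⟩ := exists_linear_witness d e P Q n
  let g : ZG d e P Q n →ₗ[ℝ] ZOm d P (n + 2) :=
    (d ∘ₗ s + ((-1 : ℝ) ^ n) • (e ∘ₗ (ZG d e P Q n).subtype)).codRestrict _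
      fun β => euler_mem_ZOm hd hde β.2.2 (hs β).2
  refine ⟨Submodule.mapQ _ _ g fun β hβ => euler_mem_BOm hd hde hβ (hs β).1 (hs β).2, ?_⟩
  intro β hβ α hα hz
  refine (Submodule.Quotient.eq _).2 ?_
  -- two witnesses of the same cocycle differ by an element of `Ω^(n+1)`
  have hdiff : d (s ⟨β, hβ⟩ - α) =
      (d (s ⟨β, hβ⟩) + ((-1 : ℝ) ^ n) • e β) - (d α + ((-1 : ℝ) ^ n) • e β) := by
    rw [map_sub, add_sub_add_right_eq_sub]
  refine ⟨s ⟨β, hβ⟩ - α, ⟨?_, ?_⟩, hdiff⟩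
  · rw [show n + 2 - 1 = n + 1 by ring]
    exact sub_mem (hs _).1 hα
  · rw [SetLike.mem_coe, Submodule.mem_comap, hdiff, show n + 2 - 1 + 1 = n + 2 by ring]
    exact sub_mem (hs ⟨β, hβ⟩).2 hz.1.1

end IG

end
end
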